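/- Let x be a chain-point for the chain V_0 ⊊ V_1 ⊊ … ⊊ V_k. For X ⊆ E define p(X) := max over Gao-trees T of |T ∩ X| and r(X) := max over spanning trees T of G of |T ∩ X|. If X ⊆ E satisfies x(X) = r(X), then p(X) = r(X). -/

import Mathlib

open Finset
open scoped Classical

variable {V : Type*} [Fintype V]

/-- The set of edges of `G` with one endpoint in `S₁` and the other in `S₂`. -/
noncomputable def cutBetween (G : SimpleGraph V) (S₁ S₂ : Finset V) : Finset (Sym2 V) :=
  G.edgeFinset.filter (fun e => ∃ u v, e = s(u, v) ∧ u ∈ S₁ ∧ v ∈ S₂)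

/-- The cut `δ(S)`: edges of `G` with exactly one endpoint in `S`. -/
noncomputable def cut (G : SimpleGraph V) (S : Finset V) : Finset (Sym2 V) :=
  cutBetween G S Sᶜ

/-- `E(S)`: edges of `G` with both endpoints in `S`. -/
noncomputable def inducedEdges (G : SimpleGraph V) (S : Finset V) : Finset (Sym2 V) :=
  G.edgeFinset.filter (fun e => ∀ v ∈ e, v ∈ S)

/-- `T` is the edge set of a spanning tree of `G`. -/
def IsSpanningTree (G : SimpleGraph V) (T : Finset (Sym2 V)) : Prop :=
  (T : Set (Sym2 V)) ⊆ G.edgeSet ∧ (SimpleGraph.fromEdgeSet (T : Set (Sym2 V))).IsTree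

/-- Characteristic vector of a set of edges. -/
noncomputable def chi (T : Finset (Sym2 V)) : Sym2 V → ℝ :=
  fun e => if e ∈ T then 1 else 0

/-- The spanning tree polytope `Sp(G)`. -/
noncomputable def spanningTreePolytope (G : SimpleGraph V) : Set (Sym2 V → ℝ) :=
  convexHull ℝ {x | ∃ T : Finset (Sym2 V), IsSpanningTree G T ∧ x = chi T}

/-- The level sets `L_i = V_i \ V_{i-1}` of a chain `V_0 ⊊ … ⊊ V_k` (with `V_{-1} = ∅`,
`V_{k+1} = V`). -/
noncomputable def level (Vc : ℕ → Finset V) (k : ℕ) : ℕ → Finset V :=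
  fun i => if i = 0 then Vc 0 else if i ≤ k then Vc i \ Vc (i - 1) else Finset.univ \ Vc k

/-- `x` is a chain-point for the chain `V_0 ⊊ … ⊊ V_k`. -/
def IsChainPoint (G : SimpleGraph V) (Vc : ℕ → Finset V) (k : ℕ) (x : Sym2 V → ℝ) : Prop :=
  x ∈ spanningTreePolytope G ∧
  (∑ e ∈ cut G (Vc 0), x e) = 1 ∧
  (∑ e ∈ cut G (Vc k), x e) = 1 ∧
  (∀ i, 1 ≤ i → i ≤ k - 1 → (∑ e ∈ cut G (Vc i), x e) < 2) ∧
  (∀ i, 1 ≤ i → i ≤ k →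
    (∑ v ∈ level Vc k i, ∑ e ∈ cut G {v}, x e) = 2 * ((level Vc k i).card : ℝ))

/-- A Gao-tree for the chain `V_0 ⊊ … ⊊ V_k`: a spanning tree meeting each cut `δ(V_i)`
in exactly one edge. -/
def IsGaoTree (G : SimpleGraph V) (Vc : ℕ → Finset V) (k : ℕ) (T : Finset (Sym2 V)) : Prop :=
  IsSpanningTree G T ∧ ∀ i ≤ k, (T ∩ cut G (Vc i)).card = 1

/-- A Gao-tree for the subchain of `V_0 ⊊ … ⊊ V_k` given by the index set `I`. -/
def IsGaoTreeOn (G : SimpleGraph V) (Vc : ℕ → Finset V) (I : Finset ℕ)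
    (T : Finset (Sym2 V)) : Prop :=
  IsSpanningTree G T ∧ ∀ i ∈ I, (T ∩ cut G (Vc i)).card = 1

/-- `Sp_𝒞(G)`: the convex hull of characteristic vectors of Gao-trees. -/
noncomputable def gaoPolytope (G : SimpleGraph V) (Vc : ℕ → Finset V) (k : ℕ) :
    Set (Sym2 V → ℝ) :=
  convexHull ℝ {x | ∃ T : Finset (Sym2 V), IsGaoTree G Vc k T ∧ x = chi T}

/-- `F` is the edge set of a spanning tree of the induced subgraph `G(U)`. -/
def IsSpanningTreeOfInduced (G : SimpleGraph V) (U : Finset V) (F : Finset (Sym2 V)) : Prop :=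
  (F : Set (Sym2 V)) ⊆ G.edgeSet ∧ (∀ e ∈ F, ∀ v ∈ e, v ∈ U) ∧
  F.card = U.card - 1 ∧
  ∀ u ∈ U, ∀ v ∈ U, (SimpleGraph.fromEdgeSet (F : Set (Sym2 V))).Reachable u v

/-- The rank of `X` in the cycle matroid of `G`. -/
noncomputable def cycleRank (G : SimpleGraph V) (X : Finset (Sym2 V)) : ℕ :=
  (G.edgeFinset.powerset.filter (fun T => IsSpanningTree G T)).sup (fun T => (T ∩ X).card)

/-- The rank of `X` in the matroid whose bases are the Gao-trees. -/
noncomputable def gaoRank (G : SimpleGraph V) (Vc : ℕ → Finset V) (k : ℕ)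
    (X : Finset (Sym2 V)) : ℕ :=
  (G.edgeFinset.powerset.filter (fun T => IsGaoTree G Vc k T)).sup (fun T => (T ∩ X).card)

/-- `x` is a solution of the `s`–`t` path TSP subtour elimination LP. -/
def IsSubtourLPSolution (G : SimpleGraph V) (s t : V) (x : Sym2 V → ℝ) : Prop :=
  x ∈ spanningTreePolytope G ∧
  (∀ v, v ≠ s → v ≠ t → (∑ e ∈ cut G {v}, x e) = 2) ∧
  (∑ e ∈ cut G {s}, x e) = 1 ∧ (∑ e ∈ cut G {t}, x e) = 1

/-- Rank function of a matroid on a finite ground set, as a function on finsets. -/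
noncomputable def mrank {E : Type*} [Fintype E] (M : Matroid E) (X : Finset E) : ℕ :=
  (X.powerset.filter (fun I : Finset E => M.Indep (I : Set E))).sup Finset.card

/-- Convex hull of characteristic vectors of independent sets of a matroid. -/
noncomputable def indepPolytope {E : Type*} [Fintype E] (M : Matroid E) : Set (E → ℝ) :=
  convexHull ℝ {x | ∃ I : Finset E, M.Indep (I : Set E) ∧
    x = fun e => if e ∈ I then (1 : ℝ) else 0}

/-- The total weight `∑_{u ∈ A} ∑_{v ∈ C} y u v` between two vertex sets. -/
noncomputable def pairSum (y : V → V → ℝ) (A C : Finset V) : ℝ :=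
  ∑ u ∈ A, ∑ v ∈ C, y u v

/-- The `0`-`1` adjacency function of a graph. -/
noncomputable def adjInd (H : SimpleGraph V) (u v : V) : ℝ := if H.Adj u v then 1 else 0

/-- The edges of `H` with both endpoints in `M`. -/
def withinSet (H : SimpleGraph V) (M : Set V) : SimpleGraph V where
  Adj u v := H.Adj u v ∧ u ∈ M ∧ v ∈ M
  symm := ⟨fun _ _ h => ⟨h.1.symm, h.2.2, h.2.1⟩⟩
  loopless := ⟨fun _ h => h.1.ne rfl⟩

omit [Fintype V] in
lemma withinSet_le (H : SimpleGraph V) (M : Set V) : withinSet H M ≤ H := fun _ _ h => h.1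

lemma pairSum_eq_sum_ite (y : V → V → ℝ) (A C : Finset V) :
    pairSum y A C = ∑ u, ∑ v, if u ∈ A ∧ v ∈ C then y u v else 0 := by
  have h (u : V) : (∑ v, if u ∈ A ∧ v ∈ C then y u v else 0) =
      if u ∈ A then ∑ v ∈ C, y u v else 0 := by
    by_cases hu : u ∈ A <;> simp [hu]
  simp only [h, pairSum, Finset.sum_ite_mem, Finset.univ_inter]

omit [Fintype V] in
lemma pairSum_comm {y : V → V → ℝ} (hy : ∀ u v, y u v = y v u) (A C : Finset V) :
    pairSum y A C = pairSum y C A := by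
  unfold pairSum
  rw [Finset.sum_comm]
  exact Finset.sum_congr rfl fun _ _ => Finset.sum_congr rfl fun _ _ => hy _ _

lemma pairSum_univ (y : V → V → ℝ) (A C : Finset V) :
    pairSum y A univ = pairSum y A C + pairSum y A Cᶜ := by
  simp only [pairSum, ← Finset.sum_add_distrib]
  exact Finset.sum_congr rfl fun u _ => (Finset.sum_add_sum_compl C _).symm

lemma pairSum_supermodular {y : V → V → ℝ} (hy : ∀ u v, 0 ≤ y u v) (A C : Finset V) :
    pairSum y A A + pairSum y C C ≤
      pairSum y (A ∩ C) (A ∩ C) + pairSum y (A ∪ C) (A ∪ C) := by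
  simp only [pairSum_eq_sum_ite, ← Finset.sum_add_distrib]
  refine Finset.sum_le_sum fun u _ => Finset.sum_le_sum fun v _ => ?_
  have := hy u v
  simp only [Finset.mem_inter, Finset.mem_union]
  by_cases h1 : u ∈ A <;> by_cases h2 : v ∈ A <;> by_cases h3 : u ∈ C <;>
    by_cases h4 : v ∈ C <;> simp [h1, h2, h3, h4, this]

/-- The numerical properties of a chain-point, for the symmetric weight function
`y u v = x_{uv}` and the level function `lev`. -/
structure LevelPoint (k : ℕ) (lev : V → ℕ) (y : V → V → ℝ) : Prop where
  symm : ∀ u v, y u v = y v u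
  nonneg : ∀ u v, 0 ≤ y u v
  le : ∀ S : Finset V, S.Nonempty → pairSum y S S ≤ 2 * #S - 2
  univ_eq : pairSum y univ univ = 2 * Fintype.card V - 2
  lev_le : ∀ v, lev v ≤ k + 1
  nonempty : ∀ i ≤ k + 1, ∃ v, lev v = i
  bottom : pairSum y {v | lev v ≤ 0} ({v | lev v ≤ 0} : Finset V)ᶜ = 1
  cut_lt : ∀ i ≤ k, pairSum y {v | lev v ≤ i} ({v | lev v ≤ i} : Finset V)ᶜ < 2
  degree : ∀ i, 1 ≤ i → i ≤ k →
    pairSum y {v | lev v = i} univ = 2 * #({v | lev v = i} : Finset V)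

namespace LevelPoint

variable {k : ℕ} {lev : V → ℕ} {y : V → V → ℝ}

lemma compl_split (h : LevelPoint k lev y) (S : Finset V) :
    pairSum y S S + 2 * pairSum y S Sᶜ + pairSum y Sᶜ Sᶜ = 2 * #S + 2 * #Sᶜ - 2 := by
  have h1 := pairSum_univ y univ S
  rw [pairSum_comm h.symm univ S, pairSum_comm h.symm univ Sᶜ, pairSum_univ y S S,
    pairSum_univ y Sᶜ S, pairSum_comm h.symm Sᶜ S, h.univ_eq] at h1
  have h2 : ((#S + #Sᶜ : ℕ) : ℝ) = Fintype.card V := by rw [Finset.card_add_card_compl]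
  push_cast at h2
  linarith

lemma pairSum_bottom (h : LevelPoint k lev y) :
    pairSum y {v | lev v ≤ 0} {v | lev v ≤ 0} =
      2 * #({v | lev v ≤ 0} : Finset V) - 2 := by
  have h1 := h.compl_split {v | lev v ≤ 0}
  obtain ⟨v, hv⟩ := h.nonempty 0 (by omega)
  obtain ⟨w, hw⟩ := h.nonempty (k + 1) le_rfl
  have h2 := h.le {v | lev v ≤ 0} ⟨v, by simp [hv]⟩
  have h3 := h.le ({v | lev v ≤ 0} : Finset V)ᶜ ⟨w, by simp [hw]⟩
  have h4 := h.bottom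
  linarith

lemma pairSum_lev_le_univ (h : LevelPoint k lev y) {j : ℕ} (hj : j ≤ k) :
    pairSum y {v | lev v ≤ j} univ = 2 * #({v | lev v ≤ j} : Finset V) - 1 := by
  induction j with
  | zero =>
    rw [pairSum_univ y _ {v | lev v ≤ 0}, h.pairSum_bottom, h.bottom]
    ring
  | succ j ih =>
    have hd : Disjoint ({v | lev v ≤ j} : Finset V) ({v | lev v = j + 1} : Finset V) := by
      rw [Finset.disjoint_left]; intro v; simp only [Finset.mem_filter, Finset.mem_univ, true_and]; omega
    have hu : ({v | lev v ≤ j + 1} : Finset V) =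
        ({v | lev v ≤ j} : Finset V) ∪ ({v | lev v = j + 1} : Finset V) := by
      ext v; simp only [Finset.mem_filter, Finset.mem_union, Finset.mem_univ, true_and]; omega
    have h1 := ih (by omega)
    have h2 := h.degree (j + 1) (by omega) hj
    unfold pairSum at h1 h2 ⊢
    rw [hu, Finset.sum_union hd, Finset.card_union_of_disjoint hd, h1, h2]
    push_cast
    ring

lemma pairSum_lev_le (h : LevelPoint k lev y) (j : ℕ) :
    2 * #({v | lev v ≤ j} : Finset V) - 3 < pairSum y {v | lev v ≤ j} {v | lev v ≤ j} := by
  by_cases hj : j ≤ k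
  · have h1 := h.pairSum_lev_le_univ hj
    rw [pairSum_univ y _ {v | lev v ≤ j}] at h1
    linarith [h.cut_lt j hj]
  · have : ({v | lev v ≤ j} : Finset V) = univ := by
      ext v; have := h.lev_le v; simp; omega
    rw [this, h.univ_eq, Finset.card_univ]
    linarith

lemma pairSum_le_lev (h : LevelPoint k lev y) {j : ℕ} (hj : j ≤ k + 1) :
    2 * #({v | j ≤ lev v} : Finset V) - 3 < pairSum y {v | j ≤ lev v} {v | j ≤ lev v} := by
  cases j with
  | zero =>
    simp only [zero_le, Finset.filter_true]
    rw [h.univ_eq, Finset.card_univ]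
    linarith
  | succ j =>
    have hc : ({v | j + 1 ≤ lev v} : Finset V) = ({v | lev v ≤ j} : Finset V)ᶜ := by
      ext v; simp
    have h1 := h.compl_split {v | lev v ≤ j}
    have h2 := h.pairSum_lev_le_univ (j := j) (by omega)
    rw [pairSum_univ y _ {v | lev v ≤ j}] at h2
    rw [hc]
    linarith [h.cut_lt j (by omega)]

/-- A tight set meets an interval of levels in a set of small deficit. -/
lemma pairSum_inter_levels (h : LevelPoint k lev y) {U : Finset V} (hU : U.Nonempty)
    (ht : pairSum y U U = 2 * #U - 2) {a b : ℕ} (hab : a ≤ b) (ha : a ≤ k + 1) :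
    2 * #({v ∈ U | a ≤ lev v ∧ lev v ≤ b}) - 4 <
      pairSum y {v ∈ U | a ≤ lev v ∧ lev v ≤ b} {v ∈ U | a ≤ lev v ∧ lev v ≤ b} := by
  set A : Finset V := {v | a ≤ lev v}
  set B : Finset V := {v | lev v ≤ b}
  have hun : A ∪ B = univ := by ext v; simp [A, B]; omega
  have hW : ({v ∈ U | a ≤ lev v ∧ lev v ≤ b}) = U ∩ (A ∩ B) := by ext v; simp [A, B]
  rw [hW]
  have h1 := h.pairSum_lev_le b
  have h2 := h.pairSum_le_lev ha
  have h3 := pairSum_supermodular h.nonneg A B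
  have h4 := pairSum_supermodular h.nonneg U (A ∩ B)
  have h5 := h.le (U ∪ (A ∩ B)) (hU.mono Finset.subset_union_left)
  have h6 : ((#(A ∪ B) + #(A ∩ B) : ℕ) : ℝ) = #A + #B := by
    exact_mod_cast Finset.card_union_add_card_inter A B
  have h7 : ((#(U ∪ (A ∩ B)) + #(U ∩ (A ∩ B)) : ℕ) : ℝ) = #U + #(A ∩ B) := by
    exact_mod_cast Finset.card_union_add_card_inter U (A ∩ B)
  rw [hun, Finset.card_univ] at h6
  rw [hun, h.univ_eq] at h3
  push_cast at h6 h7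
  linarith

/-- Less than one unit of weight skips a level. -/
lemma pairSum_skip_lt (h : LevelPoint k lev y) {i : ℕ} (hi : i + 1 ≤ k) :
    pairSum y {v | lev v ≤ i} {v | i + 2 ≤ lev v} < 1 := by
  have h1 := h.cut_lt i (by omega)
  have h2 := h.cut_lt (i + 1) hi
  have h3 := h.degree (i + 1) (by omega) hi
  obtain ⟨w, hw⟩ := h.nonempty (i + 1) (by omega)
  have h4 := h.le {v | lev v = i + 1} ⟨w, by simp [hw]⟩
  have h5 : pairSum y {v | lev v = i + 1} univ + 2 * pairSum y {v | lev v ≤ i} {v | i + 2 ≤ lev v} =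
      pairSum y {v | lev v = i + 1} {v | lev v = i + 1} +
      pairSum y ({v | lev v ≤ i} : Finset V)ᶜ {v | lev v ≤ i} +
      pairSum y {v | lev v ≤ i + 1} ({v | lev v ≤ i + 1} : Finset V)ᶜ := by
    rw [two_mul, ← add_assoc]
    nth_rw 2 [pairSum_comm h.symm {v | lev v ≤ i} {v | i + 2 ≤ lev v}]
    simp only [pairSum_eq_sum_ite, ← Finset.sum_add_distrib]
    refine Finset.sum_congr rfl fun u _ => Finset.sum_congr rfl fun v _ => ?_
    simp only [Finset.mem_filter, Finset.mem_compl, Finset.mem_univ, true_and, and_true, not_le]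
    split_ifs <;> first | omega | simp
  rw [pairSum_comm h.symm _ {v | lev v ≤ i}] at h5
  linarith

end LevelPoint

omit [Fintype V] in
lemma pairSum_adjInd_self (H : SimpleGraph V) (S : Finset V) :
    pairSum (adjInd H) S S = 2 * #(H.induce (S : Set V)).edgeFinset := by
  have h1 := (H.induce (S : Set V)).sum_degrees_eq_twice_card_edges
  have h2 (u : (S : Set V)) : ((H.induce (S : Set V)).degree u : ℝ) =
      ∑ v ∈ S, adjInd H u v := by
    rw [← SimpleGraph.card_neighborFinset_eq_degree, SimpleGraph.neighborFinset_eq_filter,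
      Finset.card_filter, ← Finset.sum_coe_sort S (fun v => adjInd H u v)]
    push_cast
    rfl
  have h3 : (((∑ v, (H.induce (S : Set V)).degree v : ℕ)) : ℝ) = pairSum (adjInd H) S S := by
    push_cast
    simp only [h2, pairSum]
    exact Finset.sum_coe_sort S (fun u => ∑ v ∈ S, adjInd H u v)
  rw [← h3, h1]
  push_cast
  ring

lemma SimpleGraph.IsAcyclic.card_edgeFinset_lt {W : Type*} [Fintype W] [Nonempty W]
    {F : SimpleGraph W} [Fintype F.edgeSet] (hF : F.IsAcyclic) : #F.edgeFinset + 1 ≤ Fintype.card W := by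
  obtain ⟨T, hFT, -, hT⟩ :=
    SimpleGraph.connected_top.exists_isTree_le_of_le_of_isAcyclic (le_top (a := F)) hF
  rw [← hT.card_edgeFinset]
  gcongr

lemma SimpleGraph.IsAcyclic.isTree_of_card {W : Type*} [Fintype W] [Nonempty W]
    {F : SimpleGraph W} [Fintype F.edgeSet] (hF : F.IsAcyclic) (hc : Fintype.card W ≤ #F.edgeFinset + 1) :
    F.IsTree := by
  obtain ⟨T, hFT, -, hT⟩ :=
    SimpleGraph.connected_top.exists_isTree_le_of_le_of_isAcyclic (le_top (a := F)) hF
  have h1 := hT.card_edgeFinset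
  have h2 := Finset.eq_of_subset_of_card_le (SimpleGraph.edgeFinset_mono hFT) (by omega)
  rwa [SimpleGraph.edgeFinset_inj.1 h2]

omit [Fintype V] in
lemma pairSum_adjInd_le {H : SimpleGraph V} (hH : H.IsAcyclic) {S : Finset V}
    (hS : S.Nonempty) : pairSum (adjInd H) S S ≤ 2 * #S - 2 := by
  have : Nonempty (S : Set V) := hS.coe_sort
  have h := (hH.induce (S : Set V)).card_edgeFinset_lt
  rw [pairSum_adjInd_self]
  have h' : ((#(H.induce (S : Set V)).edgeFinset + 1 : ℕ) : ℝ) ≤ #S := by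
    exact_mod_cast h.trans_eq (by simp)
  push_cast at h'
  linarith

omit [Fintype V] in
lemma pairSum_adjInd_eq {H : SimpleGraph V} {S : Finset V}
    (hS : (H.induce (S : Set V)).IsTree) : pairSum (adjInd H) S S = 2 * #S - 2 := by
  have h := hS.card_edgeFinset
  rw [pairSum_adjInd_self]
  have h' : ((#(H.induce (S : Set V)).edgeFinset + 1 : ℕ) : ℝ) = #S := by
    exact_mod_cast h.trans (by simp)
  push_cast at h'
  linarith

omit [Fintype V] in
lemma induce_connected_of_lt_pairSum {H : SimpleGraph V} (hH : H.IsAcyclic) {S : Finset V}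
    (hS : S.Nonempty) (h : 2 * (#S : ℝ) - 4 < pairSum (adjInd H) S S) :
    (H.induce (S : Set V)).Connected := by
  have : Nonempty (S : Set V) := hS.coe_sort
  rw [pairSum_adjInd_self] at h
  have h' : #S < #(H.induce (S : Set V)).edgeFinset + 2 := by
    have : (#S : ℝ) < ((#(H.induce (S : Set V)).edgeFinset + 2 : ℕ) : ℝ) := by
      push_cast; linarith
    exact_mod_cast this
  refine ((hH.induce (S : Set V)).isTree_of_card ?_).connected
  have h2 : Fintype.card (S : Set V) = #S := by simp
  omega

omit [Fintype V] in
/-- In an acyclic graph, an edge whose endpoints are connected within a subgraph belongs to that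
subgraph. -/
lemma SimpleGraph.IsAcyclic.adj_of_reachable_inf {H X : SimpleGraph V} (hH : H.IsAcyclic) {u v : V}
    (huv : H.Adj u v) (h : (H ⊓ X).Reachable u v) : X.Adj u v := by
  by_contra hX
  have hb := SimpleGraph.isAcyclic_iff_forall_adj_isBridge.1 hH huv
  rw [SimpleGraph.isBridge_iff] at hb
  refine hb (h.mono fun a b hab => ?_)
  rw [SimpleGraph.deleteEdges_adj]
  refine ⟨hab.1, fun he => hX ?_⟩
  rw [Set.mem_singleton_iff, Sym2.eq_iff] at he
  rcases he with ⟨rfl, rfl⟩ | ⟨rfl, rfl⟩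
  exacts [hab.2, hab.2.symm]

omit [Fintype V] in
lemma SimpleGraph.Reachable.of_forall_adj {H K : SimpleGraph V}
    (h : ∀ a b, H.Adj a b → K.Reachable a b) {u v : V} (huv : H.Reachable u v) :
    K.Reachable u v := by
  obtain ⟨p⟩ := huv
  induction p with
  | nil => exact .rfl
  | cons hab _ ih => exact (h _ _ hab).trans ih

omit [Fintype V] in
/-- A connected pair separated by a set is separated by an edge of the same component. -/
lemma SimpleGraph.Reachable.exists_adj_boundary {H : SimpleGraph V} {u v : V}
    (h : H.Reachable u v) (S : Set V) (hu : u ∈ S) (hv : v ∉ S) :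
    ∃ a b, H.Adj a b ∧ a ∈ S ∧ b ∉ S ∧ H.Reachable u a := by
  obtain ⟨p⟩ := h
  obtain ⟨d, hd, h1, h2⟩ := p.exists_boundary_dart S hu hv
  exact ⟨d.fst, d.snd, d.adj, h1, h2, ⟨p.takeUntil _ (p.dart_fst_mem_support_of_mem_darts hd)⟩⟩

/-- `y` is the convex combination of the trees `τ i` with positive coefficients `w i`. -/
structure TreeMix {ι : Type*} (t : Finset ι) (w : ι → ℝ) (τ : ι → SimpleGraph V)
    (y : V → V → ℝ) : Prop where
  pos : ∀ i ∈ t, 0 < w i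
  sum_one : ∑ i ∈ t, w i = 1
  isTree : ∀ i ∈ t, (τ i).IsTree
  eq : ∀ u v, y u v = ∑ i ∈ t, w i * adjInd (τ i) u v

namespace TreeMix

variable {ι : Type*} {t : Finset ι} {w : ι → ℝ} {τ : ι → SimpleGraph V} {y : V → V → ℝ}

omit [Fintype V] in
lemma pairSum_eq (h : TreeMix t w τ y) (A C : Finset V) :
    pairSum y A C = ∑ i ∈ t, w i * pairSum (adjInd (τ i)) A C := by
  simp only [pairSum, h.eq, Finset.mul_sum]
  conv_rhs => rw [Finset.sum_comm]
  exact Finset.sum_congr rfl fun _ _ => Finset.sum_comm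

omit [Fintype V] in
lemma sum_mul_const (h : TreeMix t w τ y) (c : ℝ) : ∑ i ∈ t, w i * c = c := by
  rw [← Finset.sum_mul, h.sum_one, one_mul]

omit [Fintype V] in
lemma nonneg (h : TreeMix t w τ y) (u v : V) : 0 ≤ y u v := by
  rw [h.eq]
  refine Finset.sum_nonneg fun i hi => mul_nonneg (h.pos i hi).le ?_
  unfold adjInd; split_ifs <;> norm_num

omit [Fintype V] in
lemma symm (h : TreeMix t w τ y) (u v : V) : y u v = y v u := by
  simp only [h.eq, adjInd, SimpleGraph.adj_comm]

omit [Fintype V] in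
lemma pairSum_le (h : TreeMix t w τ y) {S : Finset V} (hS : S.Nonempty) :
    pairSum y S S ≤ 2 * #S - 2 := by
  rw [h.pairSum_eq, ← h.sum_mul_const (2 * #S - 2)]
  exact Finset.sum_le_sum fun i hi =>
    mul_le_mul_of_nonneg_left (pairSum_adjInd_le (h.isTree i hi).isAcyclic hS) (h.pos i hi).le

omit [Fintype V] in
lemma pairSum_eq_of_forall_isTree (h : TreeMix t w τ y) {S : Finset V}
    (hS : ∀ i ∈ t, ((τ i).induce (S : Set V)).IsTree) : pairSum y S S = 2 * #S - 2 := by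
  rw [h.pairSum_eq, ← h.sum_mul_const (2 * #S - 2)]
  exact Finset.sum_congr rfl fun i hi => by rw [pairSum_adjInd_eq (hS i hi)]

omit [Fintype V] in
lemma exists_lt_pairSum (h : TreeMix t w τ y) {A C : Finset V} {c : ℝ}
    (hc : c < pairSum y A C) : ∃ i ∈ t, c < pairSum (adjInd (τ i)) A C := by
  rw [h.pairSum_eq, ← h.sum_mul_const c] at hc
  obtain ⟨i, hi, hlt⟩ := Finset.exists_lt_of_sum_lt hc
  exact ⟨i, hi, lt_of_mul_lt_mul_left hlt (h.pos i hi).le⟩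

omit [Fintype V] in
lemma exists_pairSum_lt (h : TreeMix t w τ y) {A C : Finset V} {c : ℝ}
    (hc : pairSum y A C < c) : ∃ i ∈ t, pairSum (adjInd (τ i)) A C < c := by
  rw [h.pairSum_eq, ← h.sum_mul_const c] at hc
  obtain ⟨i, hi, hlt⟩ := Finset.exists_lt_of_sum_lt hc
  exact ⟨i, hi, lt_of_mul_lt_mul_left hlt (h.pos i hi).le⟩

end TreeMix

omit [Fintype V] in
lemma one_le_pairSum_adjInd {H : SimpleGraph V} {A C : Finset V} {a b : V} (ha : a ∈ A)
    (hb : b ∈ C) (hab : H.Adj a b) : 1 ≤ pairSum (adjInd H) A C := by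
  have h0 (u v : V) : 0 ≤ adjInd H u v := by unfold adjInd; split_ifs <;> norm_num
  calc (1 : ℝ) = adjInd H a b := by simp [adjInd, hab]
    _ ≤ ∑ v ∈ C, adjInd H a v := Finset.single_le_sum (fun v _ => h0 a v) hb
    _ ≤ _ := Finset.single_le_sum
      (f := fun u => ∑ v ∈ C, adjInd H u v) (fun u _ => Finset.sum_nonneg fun v _ => h0 u v) ha

omit [Fintype V] in
lemma adj_unique_of_pairSum_lt {H : SimpleGraph V} {A C : Finset V}
    (hlt : pairSum (adjInd H) A C < 2) {a b a' b' : V} (ha : a ∈ A)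
    (hb : b ∈ C) (hab : H.Adj a b) (ha' : a' ∈ A) (hb' : b' ∈ C) (hab' : H.Adj a' b') :
    a = a' ∧ b = b' := by
  have h1 : pairSum (adjInd H) A C = ∑ p ∈ A ×ˢ C, adjInd H p.1 p.2 := by
    rw [Finset.sum_product]; rfl
  have h2 : pairSum (adjInd H) A C = #{p ∈ A ×ˢ C | H.Adj p.1 p.2} := by
    rw [h1]; simp [adjInd]
  rw [h2] at hlt
  have h3 : #{p ∈ A ×ˢ C | H.Adj p.1 p.2} ≤ 1 := by
    have : #{p ∈ A ×ˢ C | H.Adj p.1 p.2} < 2 := by exact_mod_cast hlt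
    omega
  have := Finset.card_le_one.1 h3 (a, b) (by simp [*]) (a', b') (by simp [*])
  simpa using this

/-- Every tree `τ i` spans each connected component of `X` using edges of `X` only. -/
def Spans {ι : Type*} (t : Finset ι) (τ : ι → SimpleGraph V) (X : SimpleGraph V) : Prop :=
  ∀ i ∈ t, ∀ u v, X.Adj u v → (τ i ⊓ X).Reachable u v

/-- The edges of `X` inside the levels of `lev`, together with the edges of `X` of the form
`(e i).1 (e i).2` with `i ≤ k`. -/
def levelGraph (X : SimpleGraph V) (k : ℕ) (lev : V → ℕ) (e : ℕ → V × V) : SimpleGraph V where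
  Adj u v := X.Adj u v ∧ (lev u = lev v ∨ ∃ i ≤ k, s(u, v) = s((e i).1, (e i).2))
  symm := ⟨fun u v h => ⟨h.1.symm, h.2.imp Eq.symm (by rw [Sym2.eq_swap]; exact id)⟩⟩
  loopless := ⟨fun _ h => h.1.ne rfl⟩

namespace Spans

variable {ι : Type*} {t : Finset ι} {w : ι → ℝ} {τ : ι → SimpleGraph V} {y : V → V → ℝ}
  {X : SimpleGraph V} {k : ℕ} {lev : V → ℕ}

omit [Fintype V] in
lemma reachable (hX : Spans t τ X) {i : ι} (hi : i ∈ t) {u v : V} (h : X.Reachable u v) :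
    (τ i ⊓ X).Reachable u v :=
  h.of_forall_adj (hX i hi)

lemma pairSum_component (hX : Spans t τ X) (hM : TreeMix t w τ y) (r : V) :
    pairSum y {v | X.Reachable r v} {v | X.Reachable r v} =
      2 * #({v | X.Reachable r v} : Finset V) - 2 := by
  refine hM.pairSum_eq_of_forall_isTree fun i hi => ⟨?_, (hM.isTree i hi).isAcyclic.induce _⟩
  have hs : ((({v | X.Reachable r v} : Finset V)) : Set V) =
      ((τ i ⊓ X).connectedComponentMk r).supp := by
    ext v
    simp only [Finset.coe_filter, Finset.mem_univ, true_and, Set.mem_ofPred_eq,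
      SimpleGraph.ConnectedComponent.mem_supp_iff, SimpleGraph.ConnectedComponent.eq]
    exact ⟨fun h => (hX.reachable hi h).symm, fun h => h.symm.mono inf_le_right⟩
  rw [hs]
  have hle : (((τ i ⊓ X).connectedComponentMk r).toSimpleGraph) ≤
      (τ i).induce ((τ i ⊓ X).connectedComponentMk r).supp := fun a b h => h.1
  exact ((τ i ⊓ X).connectedComponentMk r).connected_toSimpleGraph.mono hle

/-- The part of a component of `X` in an interval of levels is connected within these levels. -/
lemma reachable_withinSet (hX : Spans t τ X) (hM : TreeMix t w τ y) (hL : LevelPoint k lev y)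
    {a b : ℕ} {u v : V} (huv : X.Reachable u v) (hu : a ≤ lev u ∧ lev u ≤ b)
    (hv : a ≤ lev v ∧ lev v ≤ b) :
    (withinSet X {z | a ≤ lev z ∧ lev z ≤ b}).Reachable u v := by
  set U : Finset V := {z | X.Reachable u z} with hUdef
  have huU : u ∈ U := by simp [U]
  have h1 := hL.pairSum_inter_levels ⟨u, huU⟩ (hX.pairSum_component hM u)
    (hu.1.trans hu.2) (hu.1.trans (hL.lev_le u))
  set W : Finset V := {z ∈ U | a ≤ lev z ∧ lev z ≤ b} with hW
  have huW : u ∈ W := by simp [W, U, hu]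
  have hvW : v ∈ W := by simp [W, U, hv, huv]
  obtain ⟨i, hi, hlt⟩ := hM.exists_lt_pairSum h1
  have hacyc := (hM.isTree i hi).isAcyclic
  have hc := induce_connected_of_lt_pairSum hacyc ⟨u, huW⟩ hlt
  have hr := hc.preconnected ⟨u, huW⟩ ⟨v, hvW⟩
  refine hr.map (⟨Subtype.val, fun {p q} hpq => ?_⟩ : (τ i).induce (W : Set V) →g _)
  obtain ⟨p, hp⟩ := p
  obtain ⟨q, hq⟩ := q
  simp only [hW, hUdef, Finset.coe_filter, Finset.mem_filter, Finset.mem_univ, true_and,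
    Set.mem_ofPred_eq] at hp hq
  refine ⟨hacyc.adj_of_reachable_inf hpq (hX.reachable hi (hp.1.symm.trans hq.1)), hp.2, hq.2⟩

/-- No component of `X` skips a level. -/
lemma exists_lev_eq (hX : Spans t τ X) (hM : TreeMix t w τ y) (hL : LevelPoint k lev y)
    {i : ℕ} {u v : V} (huv : X.Reachable u v) (hi : i + 1 ≤ k) (hu : lev u ≤ i)
    (hv : i + 2 ≤ lev v) : ∃ z, X.Reachable u z ∧ lev z = i + 1 := by
  by_contra! hno
  obtain ⟨j, hj, hlt⟩ := hM.exists_pairSum_lt (hL.pairSum_skip_lt hi)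
  obtain ⟨p, q, hpq, hp, hq, hup⟩ :=
    (hX.reachable hj huv).exists_adj_boundary {z | lev z ≤ i} hu
      (by rw [Set.mem_ofPred_eq]; omega)
  have hup' : X.Reachable u p := hup.mono inf_le_right
  have h1 := hno q (hup'.trans hpq.2.reachable)
  rw [Set.mem_ofPred_eq] at hp hq
  refine hlt.not_ge (one_le_pairSum_adjInd (a := p) (b := q) ?_ ?_ hpq.1)
  · simpa using hp
  · simp; omega

lemma exists_adj_consecutive (hX : Spans t τ X) (hM : TreeMix t w τ y)
    (hL : LevelPoint k lev y) {i : ℕ} {u v : V} (huv : X.Reachable u v) (hu : lev u ≤ i)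
    (hv : i + 1 ≤ lev v) :
    ∃ p q, X.Adj p q ∧ lev p = i ∧ lev q = i + 1 ∧ X.Reachable u p := by
  have hvk := hL.lev_le v
  obtain ⟨a, hua, ha⟩ : ∃ a, X.Reachable u a ∧ lev a = i := by
    by_cases h : lev u = i
    · exact ⟨u, .rfl, h⟩
    · obtain ⟨j, rfl⟩ : ∃ j, i = j + 1 := ⟨i - 1, by omega⟩
      exact hX.exists_lev_eq hM hL huv (by omega) (by omega) (by omega)
  obtain ⟨b, hub, hb⟩ : ∃ b, X.Reachable u b ∧ lev b = i + 1 := by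
    by_cases h : lev v = i + 1
    · exact ⟨v, huv, h⟩
    · exact hX.exists_lev_eq hM hL huv (by omega) hu (by omega)
  obtain ⟨p, q, ⟨hpq, hp, hq⟩, hp', hq', hap⟩ :=
    (hX.reachable_withinSet hM hL (a := i) (b := i + 1) (hua.symm.trans hub)
      (by omega) (by omega)).exists_adj_boundary {z | lev z ≤ i} (by simp [ha]) (by simp [hb])
  simp only [Set.mem_ofPred_eq] at hp hq hp' hq'
  exact ⟨p, q, hpq, by omega, by omega, hua.trans (hap.mono (withinSet_le _ _))⟩

/-- At most one component of `X` crosses each level cut. -/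
lemma reachable_of_crossing (hX : Spans t τ X) (hM : TreeMix t w τ y)
    (hL : LevelPoint k lev y) {i : ℕ} (hi : i ≤ k) {u v u' v' : V} (huv : X.Reachable u v)
    (hu : lev u ≤ i) (hv : i < lev v) (huv' : X.Reachable u' v')
    (hu' : lev u' ≤ i) (hv' : i < lev v') : X.Reachable u u' := by
  obtain ⟨j, hj, hlt⟩ := hM.exists_pairSum_lt (hL.cut_lt i hi)
  obtain ⟨p, q, hpq, hp, hq, hup⟩ :=
    (hX.reachable hj huv).exists_adj_boundary {z | lev z ≤ i} hu (by simpa using hv)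
  obtain ⟨p', q', hpq', hp', hq', hup'⟩ :=
    (hX.reachable hj huv').exists_adj_boundary {z | lev z ≤ i} hu' (by simpa using hv')
  obtain ⟨rfl, -⟩ := adj_unique_of_pairSum_lt hlt (by simpa using hp) (by simpa using hq)
    hpq.1 (by simpa using hp') (by simpa using hq') hpq'.1
  exact (hup.trans hup'.symm).mono inf_le_right

lemma reachable_levelGraph (hX : Spans t τ X) (hM : TreeMix t w τ y) (hL : LevelPoint k lev y)
    {e : ℕ → V × V} (he : ∀ i ≤ k, lev (e i).1 = i ∧ lev (e i).2 = i + 1)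
    (heX : ∀ i ≤ k, (∃ p q, X.Adj p q ∧ lev p = i ∧ lev q = i + 1) → X.Adj (e i).1 (e i).2)
    {u v : V} (huv : X.Reachable u v) : (levelGraph X k lev e).Reachable u v := by
  have hsame {u v : V} (huv : X.Reachable u v) (h : lev u = lev v) :
      (levelGraph X k lev e).Reachable u v := by
    have hle : withinSet X {z | lev u ≤ lev z ∧ lev z ≤ lev u} ≤ levelGraph X k lev e :=
      fun p q hpq => ⟨hpq.1, .inl ((hpq.2.1.2.trans hpq.2.2.1).antisymm
        (hpq.2.2.2.trans hpq.2.1.1))⟩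
    exact (hX.reachable_withinSet hM hL huv (by omega) (by omega)).mono hle
  have hle (d : ℕ) : ∀ u v : V, X.Reachable u v → lev v = lev u + d →
      (levelGraph X k lev e).Reachable u v := by
    induction d with
    | zero => exact fun u v huv h => hsame huv (by omega)
    | succ d ih =>
      intro u v huv h
      have hk : lev u ≤ k := by have := hL.lev_le v; omega
      obtain ⟨p, q, hpq, hp, hq, hup⟩ :=
        hX.exists_adj_consecutive hM hL huv le_rfl (by omega)
      have hadj := heX _ hk ⟨p, q, hpq, hp, hq⟩
      have hlev := he _ hk
      have hue : X.Reachable u (e (lev u)).1 :=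
        hX.reachable_of_crossing hM hL hk huv le_rfl (by omega) hadj.reachable
          (by omega) (by omega)
      have hadj' : (levelGraph X k lev e).Adj (e (lev u)).1 (e (lev u)).2 :=
        ⟨hadj, .inr ⟨_, hk, rfl⟩⟩
      exact (hsame hue (by omega)).trans (hadj'.reachable.trans
        (ih _ _ ((hue.trans hadj.reachable).symm.trans huv) (by omega)))
  rcases le_total (lev u) (lev v) with h | h
  · exact hle (lev v - lev u) u v huv (by omega)
  · exact (hle (lev u - lev v) v u huv.symm (by omega)).symm

end Spans

omit [Fintype V] in
lemma exists_convex_combination_of_mem_spanningTreePolytope {G : SimpleGraph V} {x : Sym2 V → ℝ}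
    (hx : x ∈ spanningTreePolytope G) :
    ∃ (ι : Type) (t : Finset ι) (w : ι → ℝ) (T : ι → Finset (Sym2 V)),
      (∀ i ∈ t, 0 < w i) ∧ ∑ i ∈ t, w i = 1 ∧ (∀ i ∈ t, IsSpanningTree G (T i)) ∧
      ∀ e, x e = ∑ i ∈ t, w i * chi (T i) e := by
  obtain ⟨ι, _, w, z, hw, hs, hz, rfl⟩ := mem_convexHull_iff_exists_fintype.1 hx
  choose T hT hzT using hz
  have hzero {f : ι → ℝ} : ∑ i with 0 < w i, w i * f i = ∑ i, w i * f i := by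
    refine Finset.sum_filter_of_ne fun i _ hi => (hw i).lt_of_ne' fun h => hi (by simp [h])
  refine ⟨ι, univ.filter (0 < w ·), w, T, by simp, ?_, fun i _ => hT i, fun e => ?_⟩
  · simpa [hs] using hzero (f := fun _ => 1)
  · rw [hzero]
    simp [hzT]

omit [Fintype V] in
lemma chi_eq_adjInd {G : SimpleGraph V} {T : Finset (Sym2 V)} (hT : IsSpanningTree G T)
    (u v : V) : chi T s(u, v) = adjInd (SimpleGraph.fromEdgeSet (T : Set (Sym2 V))) u v := by
  have h : s(u, v) ∈ T → u ≠ v := fun h => (hT.1 h : G.Adj u v).ne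
  unfold chi adjInd
  by_cases hm : s(u, v) ∈ T
  · simp [hm, h hm]
  · simp [hm]

lemma sum_cut_eq_pairSum {G : SimpleGraph V} {x : Sym2 V → ℝ} (hx : ∀ e ∉ G.edgeSet, x e = 0)
    (S : Finset V) : ∑ e ∈ cut G S, x e = pairSum (fun u v => x s(u, v)) S Sᶜ := by
  have hinj : Set.InjOn (fun p : V × V => s(p.1, p.2)) (S ×ˢ Sᶜ : Finset (V × V)) := by
    rintro ⟨a, b⟩ hab ⟨c, d⟩ hcd h
    simp only [Finset.coe_product, Set.mem_prod, Finset.mem_coe, Finset.mem_compl] at hab hcd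
    rcases Sym2.eq_iff.1 h with ⟨rfl, rfl⟩ | ⟨rfl, rfl⟩
    · rfl
    · exact absurd hcd.1 hab.2
  unfold pairSum
  rw [← Finset.sum_product' S Sᶜ (fun u v => x s(u, v)), ← Finset.sum_image hinj (f := x)]
  refine Finset.sum_subset (fun e he => ?_) fun e he hne => hx e fun hG => hne ?_
  · obtain ⟨-, u, v, rfl, hu, hv⟩ := by simpa only [cut, cutBetween, Finset.mem_filter] using he
    exact Finset.mem_image.2 ⟨(u, v), by simpa using ⟨hu, by simpa using hv⟩, rfl⟩
  · obtain ⟨⟨u, v⟩, h, rfl⟩ := Finset.mem_image.1 he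
    rw [Finset.mem_product] at h
    simp only [cut, cutBetween, Finset.mem_filter, SimpleGraph.mem_edgeFinset]
    exact ⟨hG, u, v, rfl, h.1, h.2⟩

lemma sum_degree_eq_pairSum {G : SimpleGraph V} {x : Sym2 V → ℝ} (hx : ∀ e ∉ G.edgeSet, x e = 0)
    (S : Finset V) :
    ∑ v ∈ S, ∑ e ∈ cut G {v}, x e = pairSum (fun u v => x s(u, v)) S univ := by
  refine Finset.sum_congr rfl fun v _ => ?_
  have h0 : x s(v, v) = 0 := hx _ (by simp)
  rw [sum_cut_eq_pairSum hx, pairSum, Finset.sum_singleton,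
    ← Finset.sum_add_sum_compl {v}, Finset.sum_singleton]
  simp only [h0, zero_add]

/-- The index of the level containing a vertex. -/
noncomputable def levelIndex (Vc : ℕ → Finset V) (k : ℕ) (v : V) : ℕ :=
  #{i ∈ Finset.range (k + 1) | v ∉ Vc i}

omit [Fintype V] in
lemma levelIndex_le_iff {Vc : ℕ → Finset V} {k : ℕ} (hchain : ∀ i < k, Vc i ⊂ Vc (i + 1))
    {i : ℕ} (hi : i ≤ k) (v : V) : levelIndex Vc k v ≤ i ↔ v ∈ Vc i := by
  have hmono {a b : ℕ} (hab : a ≤ b) (hb : b ≤ k) : Vc a ⊆ Vc b := by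
    induction b, hab using Nat.le_induction with
    | base => exact subset_rfl
    | succ b _ ih => exact (ih (by omega)).trans (hchain b (by omega)).subset
  unfold levelIndex
  refine ⟨fun h => ?_, fun h => ?_⟩
  · by_contra hv
    have hsub : Finset.range (i + 1) ⊆ {j ∈ Finset.range (k + 1) | v ∉ Vc j} := fun j hj => by
      rw [Finset.mem_range] at hj
      exact Finset.mem_filter.2 ⟨Finset.mem_range.2 (by omega),
        fun h => hv (hmono (by omega) hi h)⟩
    have := Finset.card_le_card hsub
    rw [Finset.card_range] at this
    omega
  · have hsub : {j ∈ Finset.range (k + 1) | v ∉ Vc j} ⊆ Finset.range i := fun j hj => by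
      rw [Finset.mem_filter, Finset.mem_range] at hj
      rw [Finset.mem_range]
      by_contra! hij
      exact hj.2 (hmono hij (by omega) h)
    simpa using Finset.card_le_card hsub

omit [Fintype V] in
lemma levelIndex_le (Vc : ℕ → Finset V) (k : ℕ) (v : V) : levelIndex Vc k v ≤ k + 1 :=
  (Finset.card_filter_le _ _).trans_eq (Finset.card_range _)

lemma levelPoint_of_isChainPoint {G : SimpleGraph V} {Vc : ℕ → Finset V} {k : ℕ}
    (hne : (Vc 0).Nonempty) (hchain : ∀ i < k, Vc i ⊂ Vc (i + 1))
    (htop : Vc k ⊂ Finset.univ) {x : Sym2 V → ℝ} (hx : IsChainPoint G Vc k x)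
    (hx0 : ∀ e ∉ G.edgeSet, x e = 0) {ι : Type*} {t : Finset ι} {w : ι → ℝ}
    {τ : ι → SimpleGraph V} (hM : TreeMix t w τ (fun u v => x s(u, v))) :
    LevelPoint k (levelIndex Vc k) (fun u v => x s(u, v)) := by
  obtain ⟨-, h0, hk, hlt, hdeg⟩ := hx
  have hset {i : ℕ} (hi : i ≤ k) : ({v | levelIndex Vc k v ≤ i} : Finset V) = Vc i := by
    ext v; simp [levelIndex_le_iff hchain hi]
  refine ⟨hM.symm, hM.nonneg, fun S hS => hM.pairSum_le hS, ?_, levelIndex_le Vc k, ?_, ?_, ?_, ?_⟩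
  · rw [← Finset.card_univ]
    refine hM.pairSum_eq_of_forall_isTree fun i hi => ?_
    rw [Finset.coe_univ]
    exact (SimpleGraph.Iso.isTree_iff (SimpleGraph.induceUnivIso (τ i))).2 (hM.isTree i hi)
  · intro i hi
    rcases Nat.lt_or_ge k i with hki | hki
    · obtain ⟨v, -, hv⟩ := Finset.exists_of_ssubset htop
      rw [← levelIndex_le_iff hchain le_rfl] at hv
      exact ⟨v, by have := levelIndex_le Vc k v; omega⟩
    · cases i with
      | zero =>
        obtain ⟨v, hv⟩ := hne
        exact ⟨v, by have := (levelIndex_le_iff hchain hki v).2 hv; omega⟩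
      | succ i =>
        obtain ⟨v, hv, hv'⟩ := Finset.exists_of_ssubset (hchain i hki)
        rw [← levelIndex_le_iff hchain (by omega)] at hv hv'
        exact ⟨v, by omega⟩
  · rw [hset (Nat.zero_le k), ← sum_cut_eq_pairSum hx0, h0]
  · intro i hi
    rw [hset hi, ← sum_cut_eq_pairSum hx0]
    rcases Nat.eq_zero_or_pos i with rfl | hpos
    · rw [h0]; norm_num
    · rcases hi.eq_or_lt with rfl | hik
      · rw [hk]; norm_num
      · exact hlt i hpos (by omega)
  · intro i h1 hi
    have : ({v | levelIndex Vc k v = i} : Finset V) = level Vc k i := by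
      ext v
      simp only [level, show i ≠ 0 by omega, hi, if_true, if_false, Finset.mem_filter,
        Finset.mem_univ, true_and, Finset.mem_sdiff, ← levelIndex_le_iff hchain hi,
        ← levelIndex_le_iff hchain (show i - 1 ≤ k by omega)]
      omega
    rw [this, ← sum_degree_eq_pairSum hx0]
    exact hdeg i h1 hi

lemma isSpanningTree_edgeFinset {G F : SimpleGraph V} (hFG : F ≤ G) (hF : F.IsTree) :
    IsSpanningTree G F.edgeFinset := by
  rw [IsSpanningTree, SimpleGraph.coe_edgeFinset, SimpleGraph.fromEdgeSet_edgeSet]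
  exact ⟨SimpleGraph.edgeSet_mono hFG, hF⟩

lemma card_inter_le_cycleRank {G : SimpleGraph V} {T : Finset (Sym2 V)} (hT : IsSpanningTree G T)
    (X : Finset (Sym2 V)) : #(T ∩ X) ≤ cycleRank G X :=
  Finset.le_sup (f := fun T => #(T ∩ X)) <| by
    simpa [hT, Finset.subset_iff, Set.subset_def] using hT.1

lemma card_inter_le_card_inter {G : SimpleGraph V} {S T X : Finset (Sym2 V)}
    (hS : IsSpanningTree G S)
    (h : ∀ u v, s(u, v) ∈ X →
      (SimpleGraph.fromEdgeSet ((T ∩ X : Finset (Sym2 V)) : Set (Sym2 V))).Reachable u v) :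
    #(S ∩ X) ≤ #(T ∩ X) := by
  set C := SimpleGraph.fromEdgeSet (((T ∩ X) ∪ (S \ X) : Finset (Sym2 V)) : Set (Sym2 V))
  have hconn : C.Connected := by
    have := hS.2.connected.nonempty
    refine ⟨fun u v => (hS.2.connected.preconnected u v).of_forall_adj fun a b hab => ?_⟩
    rw [SimpleGraph.fromEdgeSet_adj] at hab
    by_cases hX : s(a, b) ∈ X
    · refine (h a b hX).mono (SimpleGraph.fromEdgeSet_mono ?_)
      exact_mod_cast Finset.subset_union_left
    · refine SimpleGraph.Adj.reachable ((SimpleGraph.fromEdgeSet_adj _).2 ⟨?_, hab.2⟩)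
      exact_mod_cast Finset.mem_union_right _ (Finset.mem_sdiff.2 ⟨hab.1, hX⟩)
  have h1 := hconn.card_vert_le_card_edgeSet_add_one
  have h2 : Nat.card C.edgeSet ≤ #((T ∩ X) ∪ (S \ X)) := by
    rw [← Set.ncard_coe_finset, ← Nat.card_coe_set_eq]
    exact Nat.card_mono (Finset.finite_toSet _) <| by
      rw [SimpleGraph.edgeSet_fromEdgeSet]
      exact Set.sdiff_subset
  have h3 := hS.2.card_edgeFinset
  have h4 : (SimpleGraph.fromEdgeSet (S : Set (Sym2 V))).edgeFinset = S := by
    ext e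
    simp only [SimpleGraph.mem_edgeFinset, SimpleGraph.edgeSet_fromEdgeSet]
    exact ⟨fun h => h.1, fun h => ⟨h, G.not_isDiag_of_mem_edgeSet (hS.1 h)⟩⟩
  rw [h4] at h3
  have h5 := Finset.card_union_le (T ∩ X) (S \ X)
  have h6 := Finset.card_inter_add_card_sdiff S X
  rw [Nat.card_eq_fintype_card] at h1
  omega

omit [Fintype V] in
lemma fromEdgeSet_inf (T X : Finset (Sym2 V)) :
    SimpleGraph.fromEdgeSet (T : Set (Sym2 V)) ⊓ SimpleGraph.fromEdgeSet (X : Set (Sym2 V)) =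
      SimpleGraph.fromEdgeSet ((T ∩ X : Finset (Sym2 V)) : Set (Sym2 V)) := by
  rw [Finset.coe_inter, SimpleGraph.fromEdgeSet_inter]

lemma reachable_of_card_inter_eq_cycleRank {G : SimpleGraph V} (hG : G.Connected)
    {T X : Finset (Sym2 V)} (hT : IsSpanningTree G T) (hX : (X : Set (Sym2 V)) ⊆ G.edgeSet)
    (h : #(T ∩ X) = cycleRank G X) {u v : V}
    (huv : (SimpleGraph.fromEdgeSet (X : Set (Sym2 V))).Adj u v) :
    (SimpleGraph.fromEdgeSet (T : Set (Sym2 V)) ⊓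
      SimpleGraph.fromEdgeSet (X : Set (Sym2 V))).Reachable u v := by
  by_contra hr
  rw [fromEdgeSet_inf] at hr
  set H := SimpleGraph.fromEdgeSet ((T ∩ X : Finset (Sym2 V)) : Set (Sym2 V)) with hH
  have huvX : s(u, v) ∈ X := ((SimpleGraph.fromEdgeSet_adj _).1 huv).1
  have hHT : H ≤ SimpleGraph.fromEdgeSet (T : Set (Sym2 V)) :=
    SimpleGraph.fromEdgeSet_mono (by exact_mod_cast Finset.inter_subset_left)
  have hTG : SimpleGraph.fromEdgeSet (T : Set (Sym2 V)) ≤ G := fun a b hab =>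
    hT.1 ((SimpleGraph.fromEdgeSet_adj _).1 hab).1
  have hac := (hT.2.isAcyclic.anti hHT).sup_edge_of_not_reachable hr
  have hle : H ⊔ SimpleGraph.edge u v ≤ G :=
    sup_le (hHT.trans hTG) (SimpleGraph.edge_le_iff _ |>.2 (.inr (hX huvX)))
  obtain ⟨F, hHF, hFG, hF⟩ := hG.exists_isTree_le_of_le_of_isAcyclic hle hac
  have h1 := card_inter_le_cycleRank (isSpanningTree_edgeFinset hFG hF) X
  have hnot : s(u, v) ∉ T ∩ X := fun hm => hr
    (SimpleGraph.Adj.reachable ((SimpleGraph.fromEdgeSet_adj _).2 ⟨by exact_mod_cast hm, huv.ne⟩))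
  have hsub : insert s(u, v) (T ∩ X) ⊆ F.edgeFinset ∩ X := by
    intro e he
    rw [Finset.mem_insert] at he
    rw [Finset.mem_inter, SimpleGraph.mem_edgeFinset]
    rcases he with rfl | he
    · exact ⟨hHF (Or.inr ((SimpleGraph.edge_adj ..).2 ⟨by simp, huv.ne⟩)), huvX⟩
    · refine ⟨?_, (Finset.mem_inter.1 he).2⟩
      induction e with
      | _ a b =>
        exact hHF (Or.inl ((SimpleGraph.fromEdgeSet_adj _).2 ⟨by exact_mod_cast he,
          (hT.1 (Finset.mem_inter.1 he).1 : G.Adj a b).ne⟩))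
  have h2 := Finset.card_le_card hsub
  rw [Finset.card_insert_of_notMem hnot] at h2
  omega


lemma card_inter_eq_of_sum_eq {G : SimpleGraph V} {ι : Type*} {t : Finset ι} {w : ι → ℝ}
    {T : ι → Finset (Sym2 V)} (hw : ∀ i ∈ t, 0 < w i) (hs : ∑ i ∈ t, w i = 1)
    (hT : ∀ i ∈ t, IsSpanningTree G (T i)) {X : Finset (Sym2 V)}
    (h : ∑ e ∈ X, ∑ i ∈ t, w i * chi (T i) e = cycleRank G X) :
    ∀ i ∈ t, #(T i ∩ X) = cycleRank G X := by
  have hle : ∀ i ∈ t, w i * #(T i ∩ X) ≤ w i * cycleRank G X := fun i hi =>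
    mul_le_mul_of_nonneg_left (by exact_mod_cast card_inter_le_cycleRank (hT i hi) X) (hw i hi).le
  have hsum : ∑ i ∈ t, w i * (#(T i ∩ X) : ℝ) = ∑ i ∈ t, w i * (cycleRank G X : ℝ) := by
    rw [← Finset.sum_mul, hs, one_mul, ← h, Finset.sum_comm]
    refine Finset.sum_congr rfl fun i _ => ?_
    rw [← Finset.mul_sum]
    simp [chi, Finset.inter_comm (T i)]
  intro i hi
  exact_mod_cast mul_left_cancel₀ (hw i hi).ne' ((Finset.sum_eq_sum_iff_of_le hle).1 hsum i hi)

lemma gaoRank_le_cycleRank (G : SimpleGraph V) (Vc : ℕ → Finset V) (k : ℕ)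
    (X : Finset (Sym2 V)) : gaoRank G Vc k X ≤ cycleRank G X :=
  Finset.sup_le fun _ hT => card_inter_le_cycleRank (Finset.mem_filter.1 hT).2.1 X

lemma card_inter_le_gaoRank {G : SimpleGraph V} {Vc : ℕ → Finset V} {k : ℕ}
    {T : Finset (Sym2 V)} (hT : IsGaoTree G Vc k T) (X : Finset (Sym2 V)) :
    #(T ∩ X) ≤ gaoRank G Vc k X :=
  Finset.le_sup (f := fun T => #(T ∩ X)) <| by
    simpa [hT, Finset.subset_iff, Set.subset_def] using hT.1.1

/-- A spanning tree of the level graph meets each cut in the one chosen edge. -/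
lemma isGaoTree_of_le_levelGraph {G F : SimpleGraph V} {Vc : ℕ → Finset V} {k : ℕ} {lev : V → ℕ}
    (hlev : ∀ i ≤ k, ∀ v, lev v ≤ i ↔ v ∈ Vc i) {e : ℕ → V × V}
    (he : ∀ i ≤ k, lev (e i).1 = i ∧ lev (e i).2 = i + 1)
    (hFle : F ≤ levelGraph G k lev e) (hF : F.IsTree) : IsGaoTree G Vc k F.edgeFinset := by
  have hFG : F ≤ G := fun u v h => (hFle h).1
  refine ⟨isSpanningTree_edgeFinset hFG hF, fun i hi => ?_⟩
  have heq {u v : V} (huv : F.Adj u v) (hu : lev u ≤ i) (hv : ¬ lev v ≤ i) :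
      s(u, v) = s((e i).1, (e i).2) := by
    rcases (hFle huv).2 with h | ⟨j, hj, h⟩
    · omega
    · obtain rfl : j = i := by
        have := he j hj
        rcases Sym2.eq_iff.1 h with ⟨rfl, rfl⟩ | ⟨rfl, rfl⟩ <;> omega
      exact h
  obtain ⟨p, q, hpq, hp, hq, -⟩ :=
    (hF.connected.preconnected (e i).1 (e i).2).exists_adj_boundary {z | lev z ≤ i}
      (he i hi).1.le (by simp [(he i hi).2])
  rw [Set.mem_ofPred_eq] at hp hq
  refine Finset.card_eq_one.2 ⟨s((e i).1, (e i).2), Finset.ext fun f => ?_⟩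
  simp only [cut, cutBetween, Finset.mem_inter, Finset.mem_filter, SimpleGraph.mem_edgeFinset,
    Finset.mem_compl, ← hlev i hi, Finset.mem_singleton]
  constructor
  · rintro ⟨hf, -, u, v, rfl, hu, hv⟩
    exact heq hf hu hv
  · rintro rfl
    rw [← heq hpq hp hq]
    exact ⟨hpq, hFG hpq, p, q, rfl, hp, hq⟩

theorem stmt18 (G : SimpleGraph V) (hG : G.Connected)
    (Vc : ℕ → Finset V) (k : ℕ)
    (hne : (Vc 0).Nonempty) (hchain : ∀ i < k, Vc i ⊂ Vc (i + 1))
    (htop : Vc k ⊂ Finset.univ)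
    (x : Sym2 V → ℝ) (hx : IsChainPoint G Vc k x)
    (X : Finset (Sym2 V)) (hX : (X : Set (Sym2 V)) ⊆ G.edgeSet)
    (hxX : (∑ e ∈ X, x e) = (cycleRank G X : ℝ)) :
    gaoRank G Vc k X = cycleRank G X := by
  obtain ⟨ι, t, w, T, hw, hs, hT, hxT⟩ := exists_convex_combination_of_mem_spanningTreePolytope hx.1
  have hx0 : ∀ e ∉ G.edgeSet, x e = 0 := fun e he => by
    rw [hxT]
    refine Finset.sum_eq_zero fun i hi => ?_
    have hmem : e ∉ T i := fun h => he ((hT i hi).1 h)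
    simp [chi, hmem]
  have hM : TreeMix t w (fun i => SimpleGraph.fromEdgeSet (T i : Set (Sym2 V)))
      (fun u v => x s(u, v)) :=
    ⟨hw, hs, fun i hi => (hT i hi).2, fun u v => (hxT _).trans <|
      Finset.sum_congr rfl fun i hi => by rw [chi_eq_adjInd (hT i hi)]⟩
  have hL := levelPoint_of_isChainPoint hne hchain htop hx hx0 hM
  set lev := levelIndex Vc k
  set Y := SimpleGraph.fromEdgeSet (X : Set (Sym2 V)) with hY
  have hYG : Y ≤ G := fun u v h => hX ((SimpleGraph.fromEdgeSet_adj _).1 h).1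
  have hcard := card_inter_eq_of_sum_eq hw hs hT (X := X) (by simpa only [← hxT] using hxX)
  have hYs : Spans t (fun i => SimpleGraph.fromEdgeSet (T i : Set (Sym2 V))) Y :=
    fun i hi u v huv => reachable_of_card_inter_eq_cycleRank hG (hT i hi) hX (hcard i hi) huv
  have hGs : Spans t (fun i => SimpleGraph.fromEdgeSet (T i : Set (Sym2 V))) G := by
    intro i hi u v _
    rw [inf_eq_left.2 fun a b hab => (hT i hi).1 ((SimpleGraph.fromEdgeSet_adj _).1 hab).1]
    exact (hT i hi).2.connected.preconnected u v
  have hex (i : ℕ) : ∃ e : V × V, i ≤ k → G.Adj e.1 e.2 ∧ lev e.1 = i ∧ lev e.2 = i + 1 ∧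
      ((∃ p q, Y.Adj p q ∧ lev p = i ∧ lev q = i + 1) → Y.Adj e.1 e.2) := by
    by_cases h : ∃ p q, Y.Adj p q ∧ lev p = i ∧ lev q = i + 1
    · obtain ⟨p, q, hpq, hp, hq⟩ := h
      exact ⟨(p, q), fun _ => ⟨hYG hpq, hp, hq, fun _ => hpq⟩⟩
    · have hi0 := hG.nonempty.some
      by_cases hi : i ≤ k
      · obtain ⟨u, hu⟩ := hL.nonempty i (by omega)
        obtain ⟨v, hv⟩ := hL.nonempty (i + 1) (by omega)
        obtain ⟨p, q, hpq, hp, hq, -⟩ :=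
          hGs.exists_adj_consecutive hM hL (hG.preconnected u v) hu.le hv.ge
        exact ⟨(p, q), fun _ => ⟨hpq, hp, hq, fun h' => absurd h' h⟩⟩
      · exact ⟨(hi0, hi0), fun h => absurd h hi⟩
  choose e he using hex
  have hlev : ∀ i ≤ k, lev (e i).1 = i ∧ lev (e i).2 = i + 1 :=
    fun i hi => ⟨(he i hi).2.1, (he i hi).2.2.1⟩
  have hHconn : (levelGraph G k lev e).Connected := by
    have := hG.nonempty
    exact ⟨fun u v => hGs.reachable_levelGraph hM hL hlev (fun i hi _ => (he i hi).1)
      (hG.preconnected u v)⟩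
  have hle : levelGraph Y k lev e ≤ levelGraph G k lev e := fun u v h => ⟨hYG h.1, h.2⟩
  obtain ⟨F₀, hF₀Y, hF₀, hreach⟩ :=
    (levelGraph Y k lev e).exists_isAcyclic_reachable_eq_le
  obtain ⟨F, hF₀F, hFle, hF⟩ :=
    hHconn.exists_isTree_le_of_le_of_isAcyclic (hF₀Y.trans hle) hF₀
  have hgao := isGaoTree_of_le_levelGraph (fun i hi v => levelIndex_le_iff hchain hi v) hlev hFle hF
  obtain ⟨i, hi⟩ : t.Nonempty := Finset.nonempty_of_sum_ne_zero (hs ▸ one_ne_zero)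
  refine (gaoRank_le_cycleRank G Vc k X).antisymm ?_
  rw [← hcard i hi]
  refine (card_inter_le_card_inter (hT i hi) fun u v huv => ?_).trans
    (card_inter_le_gaoRank hgao X)
  have huvY : Y.Adj u v := (SimpleGraph.fromEdgeSet_adj _).2 ⟨huv, (hX huv : G.Adj u v).ne⟩
  have h := hYs.reachable_levelGraph hM hL hlev (fun i hi => (he i hi).2.2.2) huvY.reachable
  rw [← hreach] at h
  refine h.mono fun a b hab => (SimpleGraph.fromEdgeSet_adj _).2 ⟨?_, hab.ne⟩
  have hX' : s(a, b) ∈ X := ((SimpleGraph.fromEdgeSet_adj _).1 (hF₀Y hab).1).1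
  simpa [hX'] using hF₀F hab
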